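/- Let m ≥ 1, let ω : ℝᵐ → ℝ be measurable and positive almost everywhere, let R > 0, and let u : ℝᵐ → ℝ be continuously differentiable with compact support contained in closedBall(0,R) and with u(0) = 1. Then, with both factors on the right interpreted as extended-real integrals in [0,∞], (m · vol(B(0,1)))² ≤ (∫_{B(0,R)} ‖∇u(y)‖² ω(y) dy) · (∫_{B(0,R)} ‖y‖^{2(1−m)} ω(y)^{−1} dy), where vol(B(0,1)) is the Lebesgue measure of the unit ball in ℝᵐ. -/

import Mathlib

open MeasureTheory Metric NNReal ENNReal

/-- Polar coordinates for the lower Lebesgue integral with respect to a Haar measure. -/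
theorem lintegral_eq_lintegral_toSphere {E : Type*} [NormedAddCommGroup E] [NormedSpace ℝ E]
    [Nontrivial E] [FiniteDimensional ℝ E] [MeasurableSpace E] [BorelSpace E]
    (μ : Measure E) [μ.IsAddHaarMeasure] {f : E → ℝ≥0∞} (hf : Measurable f) :
    ∫⁻ x, f x ∂μ = ∫⁻ s : sphere (0 : E) 1, ∫⁻ r in Set.Ioi (0 : ℝ),
      ENNReal.ofReal (r ^ (Module.finrank ℝ E - 1)) * f (r • (s : E)) ∂volume ∂μ.toSphere := by
  have hmp := (μ.measurePreserving_homeomorphUnitSphereProd).symm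
    (homeomorphUnitSphereProd E).toMeasurableEquiv
  have hfs : Measurable fun p : sphere (0 : E) 1 × Set.Ioi (0 : ℝ) ↦ f (p.2.1 • p.1.1) :=
    hf.comp (by fun_prop)
  calc ∫⁻ x, f x ∂μ = ∫⁻ x in {(0 : E)}ᶜ, f x ∂μ := by rw [restrict_compl_singleton]
    _ = ∫⁻ x : ({0}ᶜ : Set E), f x ∂(μ.comap (↑)) :=
      (lintegral_subtype_comap (measurableSet_singleton _).compl f).symm
    _ = ∫⁻ p, f (p.2.1 • p.1.1)
          ∂(μ.toSphere.prod (Measure.volumeIoiPow (Module.finrank ℝ E - 1))) :=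
      (hmp.lintegral_comp (hf.comp measurable_subtype_coe)).symm
    _ = ∫⁻ s, ∫⁻ r : Set.Ioi (0 : ℝ), f (r.1 • (s : E))
          ∂(Measure.volumeIoiPow (Module.finrank ℝ E - 1)) ∂μ.toSphere :=
      lintegral_prod _ hfs.aemeasurable
    _ = _ := by
      refine lintegral_congr fun s ↦ ?_
      have hray : Measurable fun r : Set.Ioi (0 : ℝ) ↦ f (r.1 • (s : E)) := hf.comp (by fun_prop)
      rw [Measure.volumeIoiPow, lintegral_withDensity_eq_lintegral_mul _ (by fun_prop) hray]
      exact lintegral_subtype_comap measurableSet_Ioi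
        fun r : ℝ ↦ ENNReal.ofReal (r ^ (Module.finrank ℝ E - 1)) * f (r • (s : E))

/-- The increment of a `C¹` function along a segment issued from the origin is at most the
integral of the norm of its derivative along that segment. -/
theorem enorm_sub_le_lintegral_enorm_fderiv_smul {E : Type*} [NormedAddCommGroup E]
    [NormedSpace ℝ E] {u : E → ℝ} (hu : ContDiff ℝ 1 u) {s : E} (hs : ‖s‖ = 1) {R : ℝ}
    (hR : 0 ≤ R) :
    ‖u (R • s) - u 0‖ₑ ≤ ∫⁻ r in Set.Ioo 0 R, ‖fderiv ℝ u (r • s)‖ₑ := by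
  have hcont : Continuous fun r : ℝ ↦ fderiv ℝ u (r • s) s :=
    ((hu.continuous_fderiv one_ne_zero).comp (by fun_prop)).clm_apply continuous_const
  have hderiv (r : ℝ) : HasDerivAt (fun r : ℝ ↦ u (r • s)) (fderiv ℝ u (r • s) s) r := by
    have hline : HasDerivAt (fun r : ℝ ↦ r • s) s r := by
      simpa using (hasDerivAt_id r).smul_const s
    exact ((hu.differentiable one_ne_zero (r • s)).hasFDerivAt).comp_hasDerivAt r hline
  have hftc := intervalIntegral.integral_eq_sub_of_hasDerivAt (a := 0) (b := R)
    (fun r _ ↦ hderiv r) (hcont.intervalIntegrable _ _)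
  rw [zero_smul, intervalIntegral.integral_of_le hR, integral_Ioc_eq_integral_Ioo] at hftc
  rw [← hftc]
  refine (enorm_integral_le_lintegral_enorm _).trans (lintegral_mono fun r ↦ ?_)
  have hs' : ‖s‖ₑ = 1 := by rw [← ofReal_norm, hs, ENNReal.ofReal_one]
  simpa [hs'] using (fderiv ℝ u (r • s)).le_opENorm s

/-- A continuous function supported in the closed ball of radius `R ≠ 0` vanishes outside the open
ball. -/
theorem Continuous.eq_zero_of_tsupport_subset_closedBall {E : Type*} [NormedAddCommGroup E]
    [NormedSpace ℝ E] {u : E → ℝ} (hu : Continuous u) {c : E} {R : ℝ} (hR : R ≠ 0)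
    (h : tsupport u ⊆ closedBall c R) {x : E} (hx : x ∉ ball c R) : u x = 0 := by
  by_contra hne
  have hsub : Function.support u ⊆ interior (closedBall c R) :=
    interior_maximal ((subset_tsupport u).trans h) hu.isOpen_support
  rw [interior_closedBall c hR] at hsub
  exact hx (hsub hne)

/-- Lower bound for the integral of `‖∇u‖ ‖y‖^(1-d)` over a ball of a `d`-dimensional space, for
`u` supported in the closure of that ball. -/
theorem finrank_mul_measure_ball_mul_enorm_le_lintegral {E : Type*} [NormedAddCommGroup E]
    [NormedSpace ℝ E] [Nontrivial E] [FiniteDimensional ℝ E] [MeasurableSpace E] [BorelSpace E]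
    (μ : Measure E) [μ.IsAddHaarMeasure] {u : E → ℝ} (hu : ContDiff ℝ 1 u) {R : ℝ} (hR : 0 < R)
    (hsupp : tsupport u ⊆ closedBall 0 R) :
    Module.finrank ℝ E * μ (ball 0 1) * ‖u 0‖ₑ ≤
      ∫⁻ y in ball 0 R,
        ‖fderiv ℝ u y‖ₑ * ENNReal.ofReal ‖y‖ ^ (1 - (Module.finrank ℝ E : ℝ)) ∂μ := by
  set d := Module.finrank ℝ E
  have hd1 : 1 ≤ d := Module.finrank_pos
  have hcont := hu.continuous_fderiv one_ne_zero
  have hmeas : Measurable fun y : E ↦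
      ‖fderiv ℝ u y‖ₑ * ENNReal.ofReal ‖y‖ ^ (1 - (d : ℝ)) :=
    hcont.enorm.measurable.mul (by fun_prop)
  rw [← lintegral_indicator measurableSet_ball,
    lintegral_eq_lintegral_toSphere μ (hmeas.indicator measurableSet_ball),
    ← Measure.toSphere_apply_univ, mul_comm, ← lintegral_const]
  refine lintegral_mono fun s ↦ ?_
  have hs : ‖(s : E)‖ = 1 := norm_eq_of_mem_sphere s
  have hzero : u (R • (s : E)) = 0 :=
    hu.continuous.eq_zero_of_tsupport_subset_closedBall hR.ne' hsupp
      (by simp [norm_smul, hs, abs_of_pos hR])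
  have hray := enorm_sub_le_lintegral_enorm_fderiv_smul hu hs hR.le
  rw [hzero, zero_sub, enorm_neg] at hray
  refine hray.trans ?_
  calc ∫⁻ r in Set.Ioo 0 R, ‖fderiv ℝ u (r • (s : E))‖ₑ
      = ∫⁻ r in Set.Ioo 0 R, ENNReal.ofReal (r ^ (d - 1)) * (ball (0 : E) R).indicator
          (fun y ↦ ‖fderiv ℝ u y‖ₑ * ENNReal.ofReal ‖y‖ ^ (1 - (d : ℝ))) (r • (s : E)) := by
        refine setLIntegral_congr_fun measurableSet_Ioo fun r hr ↦ ?_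
        have hnorm : ‖r • (s : E)‖ = r := by rw [norm_smul, hs, mul_one, Real.norm_of_nonneg hr.1.le]
        have hmem : r • (s : E) ∈ ball (0 : E) R := by simpa [hnorm] using hr.2
        have hcancel : ENNReal.ofReal (r ^ (d - 1)) * ENNReal.ofReal r ^ (1 - (d : ℝ)) = 1 := by
          rw [ENNReal.ofReal_rpow_of_pos hr.1, ← ENNReal.ofReal_mul (pow_nonneg hr.1.le _),
            ← Real.rpow_natCast, ← Real.rpow_add hr.1, Nat.cast_sub hd1]
          simp
        simp only [Set.indicator_of_mem hmem, hnorm]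
        rw [mul_left_comm, hcancel, mul_one]
    _ ≤ _ := lintegral_mono_set Set.Ioo_subset_Ioi_self

/-- The Cauchy–Schwarz inequality for lower Lebesgue integrals, with a weight `w`. -/
theorem sq_lintegral_mul_le_lintegral_mul_weight {α : Type*} [MeasurableSpace α] {μ : Measure α}
    {f g w : α → ℝ≥0∞} (hf : AEMeasurable f μ) (hg : AEMeasurable g μ) (hw : AEMeasurable w μ)
    (hw0 : ∀ᵐ x ∂μ, w x ≠ 0) (hwtop : ∀ᵐ x ∂μ, w x ≠ ∞) :
    (∫⁻ x, f x * g x ∂μ) ^ 2 ≤ (∫⁻ x, f x ^ 2 * w x ∂μ) * ∫⁻ x, g x ^ 2 * (w x)⁻¹ ∂μ := by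
  have hholder := ENNReal.lintegral_mul_le_Lp_mul_Lq μ Real.HolderConjugate.two_two
    (hf.mul (hw.pow_const (1 / 2 : ℝ))) (hg.mul (hw.inv.pow_const (1 / 2 : ℝ)))
  have hsqrt (a : ℝ≥0∞) : (a ^ (1 / 2 : ℝ)) ^ 2 = a := by
    rw [← ENNReal.rpow_natCast, ← ENNReal.rpow_mul]
    norm_num
  have hprod : ∫⁻ x, f x * g x ∂μ =
      ∫⁻ x, ((f * fun x ↦ w x ^ (1 / 2 : ℝ)) * (g * fun x ↦ w⁻¹ x ^ (1 / 2 : ℝ))) x ∂μ := by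
    refine lintegral_congr_ae ?_
    filter_upwards [hw0, hwtop] with x h0 htop
    simp only [Pi.mul_apply, Pi.inv_apply]
    rw [mul_mul_mul_comm, ← ENNReal.mul_rpow_of_nonneg _ _ (by norm_num),
      ENNReal.mul_inv_cancel h0 htop, ENNReal.one_rpow, mul_one]
  rw [← hprod] at hholder
  calc (∫⁻ x, f x * g x ∂μ) ^ 2 ≤ _ := pow_le_pow_left₀ zero_le hholder 2
    _ = _ := by
      rw [mul_pow, hsqrt, hsqrt]
      simp only [Pi.mul_apply, Pi.inv_apply, ENNReal.rpow_two, mul_pow, hsqrt]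

/-- Weighted capacity lower bound for a point: if `ω > 0` a.e. on `ℝᵐ`, `R > 0`, and
`u ∈ C¹` has compact support contained in `closedBall(0,R)` with `u(0) = 1`, then
`(m · vol(B(0,1)))² ≤ (∫_{B(0,R)} ‖∇u‖² ω) · (∫_{B(0,R)} ‖y‖^{2(1-m)} ω⁻¹)`,
both factors taken as extended-real integrals in `[0,∞]`. -/
theorem statement9 (m : ℕ) (hm : 1 ≤ m) (ω : EuclideanSpace ℝ (Fin m) → ℝ)
    (hω : Measurable ω)
    (hpos : ∀ᵐ y ∂(volume : Measure (EuclideanSpace ℝ (Fin m))), 0 < ω y)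
    (R : ℝ) (hR : 0 < R) (u : EuclideanSpace ℝ (Fin m) → ℝ)
    (hu : ContDiff ℝ 1 u) (hsupp : HasCompactSupport u)
    (hsuppR : tsupport u ⊆ closedBall (0 : EuclideanSpace ℝ (Fin m)) R)
    (hu0 : u 0 = 1) :
    ((m : ℝ≥0∞) * volume (ball (0 : EuclideanSpace ℝ (Fin m)) 1)) ^ 2 ≤
      (∫⁻ y in ball (0 : EuclideanSpace ℝ (Fin m)) R,
          ENNReal.ofReal (‖gradient u y‖ ^ 2) * ENNReal.ofReal (ω y)) *
        (∫⁻ y in ball (0 : EuclideanSpace ℝ (Fin m)) R,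
          (ENNReal.ofReal ‖y‖) ^ (2 * (1 - (m : ℝ))) * (ENNReal.ofReal (ω y))⁻¹) := by
  have : Nonempty (Fin m) := ⟨⟨0, hm⟩⟩
  have hbound := finrank_mul_measure_ball_mul_enorm_le_lintegral
    (volume : Measure (EuclideanSpace ℝ (Fin m))) hu hR hsuppR
  rw [hu0, finrank_euclideanSpace_fin, enorm_one, mul_one] at hbound
  have hpos' : ∀ᵐ y ∂(volume.restrict (ball (0 : EuclideanSpace ℝ (Fin m)) R)),
      ENNReal.ofReal (ω y) ≠ 0 := by
    filter_upwards [ae_restrict_of_ae hpos] with y hy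
    simpa using hy
  have hcs := sq_lintegral_mul_le_lintegral_mul_weight
    (μ := volume.restrict (ball (0 : EuclideanSpace ℝ (Fin m)) R))
    (hu.continuous_fderiv one_ne_zero).enorm.measurable.aemeasurable
    (g := fun y ↦ ENNReal.ofReal ‖y‖ ^ (1 - (m : ℝ))) (by fun_prop)
    hω.ennreal_ofReal.aemeasurable hpos' (.of_forall fun _ ↦ ENNReal.ofReal_ne_top)
  refine (pow_le_pow_left₀ zero_le hbound 2).trans (hcs.trans_eq ?_)
  congr 1
  · refine lintegral_congr fun y ↦ ?_
    rw [gradient, LinearIsometryEquiv.norm_map, ENNReal.ofReal_pow (norm_nonneg _), ofReal_norm]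
  · refine lintegral_congr fun y ↦ ?_
    rw [← ENNReal.rpow_natCast, ← ENNReal.rpow_mul, mul_comm (1 - (m : ℝ)), Nat.cast_ofNat]
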